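/- For every nonnegative integer n, the number of square-lattice walks of length n from (0,0) to (−1,0) confined to the three-quadrant cone C equals the number of diagonal-lattice walks of length n from (0,0) to (−1,1) confined to C. -/

import Mathlib

/-- Square-lattice steps. -/
def squareSteps : Set (ℤ × ℤ) := {(1,0), (-1,0), (0,1), (0,-1)}

/-- Diagonal-lattice steps. -/
def diagSteps : Set (ℤ × ℤ) := {(1,1), (1,-1), (-1,1), (-1,-1)}

/-- The three-quadrant cone `C = {(i,j) : i ≥ 0 or j ≥ 0}`. -/
def coneC : Set (ℤ × ℤ) := {p | 0 ≤ p.1 ∨ 0 ≤ p.2}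

/-- The quadrant `Q = {(i,j) : i ≥ 0 and j ≥ 0}`. -/
def quadQ : Set (ℤ × ℤ) := {p | 0 ≤ p.1 ∧ 0 ≤ p.2}

/-- Number of walks of length `n` with steps in `steps`, from `a` to `b`,
confined to `region`. -/
noncomputable def walkCount (steps region : Set (ℤ × ℤ)) (a b : ℤ × ℤ) (n : ℕ) : ℕ :=
  Nat.card {w : Fin (n+1) → ℤ × ℤ //
    w 0 = a ∧ w (Fin.last n) = b ∧
    (∀ k : Fin n, w k.succ - w k.castSucc ∈ steps) ∧
    (∀ k, w k ∈ region)}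

/-! ### First-step decomposition and reversal of walks -/

/-- The walks counted by `walkCount`. -/
abbrev Walks (steps region : Set (ℤ × ℤ)) (a b : ℤ × ℤ) (n : ℕ) : Type :=
  {w : Fin (n+1) → ℤ × ℤ //
    w 0 = a ∧ w (Fin.last n) = b ∧
    (∀ k : Fin n, w k.succ - w k.castSucc ∈ steps) ∧
    (∀ k, w k ∈ region)}

theorem isEmpty_walks_of_notMem {steps region : Set (ℤ × ℤ)} {a b : ℤ × ℤ} {n : ℕ}
    (ha : a ∉ region) : IsEmpty (Walks steps region a b n) :=
  ⟨fun w => ha (w.2.1 ▸ w.2.2.2.2 0)⟩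

/-- A nonempty walk is its first step followed by a shorter walk. -/
def walksSuccEquiv {steps region : Set (ℤ × ℤ)} {a : ℤ × ℤ} (b : ℤ × ℤ) (n : ℕ)
    (ha : a ∈ region) :
    Walks steps region a b (n + 1) ≃ Σ s : steps, Walks steps region (a + s) b n where
  toFun w := ⟨⟨w.1 1 - w.1 0, w.2.2.2.1 0⟩, ⟨fun k => w.1 k.succ,
    by simp [w.2.1], w.2.2.1, fun k => w.2.2.2.1 k.succ, fun k => w.2.2.2.2 k.succ⟩⟩
  invFun p := ⟨Fin.cons a p.2.1, rfl, p.2.2.2.1, by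
    intro k
    refine Fin.cases ?_ (fun k => ?_) k
    · have h := p.2.2.1
      simp [h]
    · exact p.2.2.2.2.1 k, by
    intro k
    refine Fin.cases ?_ (fun k => ?_) k
    · exact ha
    · exact p.2.2.2.2.2 k⟩
  left_inv w := by
    apply Subtype.ext
    funext k
    refine Fin.cases ?_ (fun k => ?_) k
    · exact w.2.1.symm
    · rfl
  right_inv p := by
    obtain ⟨⟨s, hs⟩, ⟨w, h0, h1, h2, h3⟩⟩ := p
    have key : ∀ t : steps, t.1 = s → ∀ h, (⟨t, ⟨w, h⟩⟩ : Σ s : steps,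
        Walks steps region (a + s) b n) = ⟨⟨s, hs⟩, ⟨w, h0, h1, h2, h3⟩⟩ := by
      rintro ⟨t, ht⟩ rfl h
      rfl
    refine key ⟨_, _⟩ ?_ _
    change w 0 - a = s
    rw [h0]
    simp

theorem finite_walks {steps : Set (ℤ × ℤ)} (hs : steps.Finite) (region : Set (ℤ × ℤ))
    (b : ℤ × ℤ) (n : ℕ) (a : ℤ × ℤ) : Finite (Walks steps region a b n) := by
  induction n generalizing a with
  | zero =>
    have : Subsingleton (Walks steps region a b 0) := by
      refine ⟨fun v w => Subtype.ext (funext fun k => ?_)⟩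
      rw [Fin.fin_one_eq_zero k, v.2.1, w.2.1]
    infer_instance
  | succ n ih =>
    by_cases ha : a ∈ region
    · have := hs.to_subtype
      exact Finite.of_equiv _ (walksSuccEquiv b n ha).symm
    · have := isEmpty_walks_of_notMem (steps := steps) (b := b) (n := n + 1) ha
      infer_instance

theorem walkCount_of_notMem {steps region : Set (ℤ × ℤ)} {a b : ℤ × ℤ} {n : ℕ}
    (ha : a ∉ region) : walkCount steps region a b n = 0 := by
  have := isEmpty_walks_of_notMem (steps := steps) (b := b) (n := n) ha
  exact Nat.card_of_isEmpty

theorem walkCount_zero {steps region : Set (ℤ × ℤ)} {a b : ℤ × ℤ} (ha : a ∈ region) :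
    walkCount steps region a b 0 = if a = b then 1 else 0 := by
  split_ifs with h
  · refine Nat.card_eq_one_iff_unique.2 ⟨⟨fun v w => Subtype.ext (funext fun k => ?_)⟩,
      ⟨⟨fun _ => a, rfl, h, fun k => k.elim0, fun _ => ha⟩⟩⟩
    rw [Fin.fin_one_eq_zero k, v.2.1, w.2.1]
  · have : IsEmpty (Walks steps region a b 0) := ⟨fun w => h (w.2.1.symm.trans w.2.2.1)⟩
    exact Nat.card_of_isEmpty

theorem walkCount_succ (steps : Finset (ℤ × ℤ)) {region : Set (ℤ × ℤ)} {a : ℤ × ℤ}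
    (b : ℤ × ℤ) (n : ℕ) (ha : a ∈ region) :
    walkCount steps region a b (n + 1) = ∑ s ∈ steps, walkCount steps region (a + s) b n := by
  have := finite_walks steps.finite_toSet region b n
  rw [← Finset.sum_coe_sort steps]
  exact (Nat.card_congr (walksSuccEquiv b n ha)).trans Nat.card_sigma

/-- Reversing walks exchanges their endpoints. -/
theorem walkCount_comm {steps : Set (ℤ × ℤ)} (hs : ∀ s ∈ steps, -s ∈ steps)
    (region : Set (ℤ × ℤ)) (a b : ℤ × ℤ) (n : ℕ) :
    walkCount steps region a b n = walkCount steps region b a n := by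
  have rev : ∀ {a b : ℤ × ℤ} {w : Fin (n+1) → ℤ × ℤ}, (w 0 = a ∧ w (Fin.last n) = b ∧
      (∀ k : Fin n, w k.succ - w k.castSucc ∈ steps) ∧ (∀ k, w k ∈ region)) →
      ((w ∘ Fin.rev) 0 = b ∧ (w ∘ Fin.rev) (Fin.last n) = a ∧
      (∀ k : Fin n, (w ∘ Fin.rev) k.succ - (w ∘ Fin.rev) k.castSucc ∈ steps) ∧
      (∀ k, (w ∘ Fin.rev) k ∈ region)) := by
    rintro a b w ⟨h0, h1, h2, h3⟩
    refine ⟨by simpa using h1, by simpa using h0, fun k => ?_, fun k => h3 _⟩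
    have := hs _ (h2 k.rev)
    simpa [Fin.rev_succ, Fin.rev_castSucc] using this
  refine Nat.card_congr ⟨fun w => ⟨_, rev w.2⟩, fun w => ⟨_, rev w.2⟩, fun w => ?_, fun w => ?_⟩
  all_goals
    apply Subtype.ext
    funext k
    simp

theorem walkCount_squareSteps_succ {region : Set (ℤ × ℤ)} {i j : ℤ} (b : ℤ × ℤ) (n : ℕ)
    (ha : (i, j) ∈ region) :
    walkCount squareSteps region (i, j) b (n + 1) =
      walkCount squareSteps region (i + 1, j) b n + walkCount squareSteps region (i - 1, j) b n +
      walkCount squareSteps region (i, j + 1) b n +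
      walkCount squareSteps region (i, j - 1) b n := by
  have h : squareSteps = (({(1,0), (-1,0), (0,1), (0,-1)} : Finset (ℤ × ℤ)) : Set (ℤ × ℤ)) := by
    simp [squareSteps]
  rw [h, walkCount_succ _ b n ha]
  simp [← sub_eq_add_neg, add_assoc]

theorem walkCount_diagSteps_succ {region : Set (ℤ × ℤ)} {i j : ℤ} (b : ℤ × ℤ) (n : ℕ)
    (ha : (i, j) ∈ region) :
    walkCount diagSteps region (i, j) b (n + 1) =
      walkCount diagSteps region (i + 1, j + 1) b n +
      walkCount diagSteps region (i + 1, j - 1) b n +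
      walkCount diagSteps region (i - 1, j + 1) b n +
      walkCount diagSteps region (i - 1, j - 1) b n := by
  have h : diagSteps = (({(1,1), (1,-1), (-1,1), (-1,-1)} : Finset (ℤ × ℤ)) : Set (ℤ × ℤ)) := by
    simp [diagSteps]
  rw [h, walkCount_succ _ b n ha]
  simp [← sub_eq_add_neg, add_assoc]

/-! ### Walks on the cover of the punctured square lattice

A point of the universal cover of `ℤ² \ {0}` is written `(q, x, y)` with `0 < x` and `0 ≤ y`:
it is the point obtained by rotating `(x, y)` by `q` quarter turns. -/

namespace QuadrantCover

/-- The sum of `f` over the neighbours of a point of the cover. -/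
def nbrSum (f : ℤ → ℤ → ℤ → ℤ) (q x y : ℤ) : ℤ :=
  f q (x + 1) y + (if x = 1 then (if y = 0 then 0 else f (q + 1) y 0) else f q (x - 1) y) +
    f q x (y + 1) + (if y = 0 then f (q - 1) 1 x else f q x (y - 1))

/-- Composition of `f` with the reflection of the cover sending the angle `θ` to `k π / 2 - θ`. -/
def reflect (k : ℤ) (f : ℤ → ℤ → ℤ → ℤ) (q x y : ℤ) : ℤ :=
  if y = 0 then f (k - q) x 0 else f (k - 1 - q) y x

/-- The number of walks of length `n` from `(q, x, y)` to a point `(q', 1, 0)` with `6 ∣ q'`. -/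
def count : ℕ → ℤ → ℤ → ℤ → ℤ
  | 0 => fun q x y => if 6 ∣ q ∧ x = 1 ∧ y = 0 then 1 else 0
  | n + 1 => nbrSum (count n)

/-- The antisymmetrization of `count` under a reflection. -/
def altCount (k : ℤ) (n : ℕ) (q x y : ℤ) : ℤ := count n q x y - reflect k (count n) q x y

theorem nbrSum_congr {f g : ℤ → ℤ → ℤ → ℤ}
    (h : ∀ q x y, 0 < x → 0 ≤ y → f q x y = g q x y) {q x y : ℤ} (hx : 0 < x) (hy : 0 ≤ y) :
    nbrSum f q x y = nbrSum g q x y := by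
  unfold nbrSum
  rw [h q (x + 1) y (by omega) hy, h q x (y + 1) hx (by omega)]
  congr 1
  · congr 2
    split_ifs
    · rfl
    · exact h _ _ _ (by omega) le_rfl
    · exact h _ _ _ (by omega) hy
  · split_ifs
    · exact h _ _ _ (by omega) (by omega)
    · exact h _ _ _ hx (by omega)

theorem nbrSum_reflect (k : ℤ) (f : ℤ → ℤ → ℤ → ℤ) {q x y : ℤ} (hx : 0 < x) (hy : 0 ≤ y) :
    nbrSum (reflect k f) q x y = reflect k (nbrSum f) q x y := by
  have e1 : k - 1 - (q - 1) = k - q := by ring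
  have e2 : k - (q + 1) = k - 1 - q := by ring
  have e3 : k - q - 1 = k - 1 - q := by ring
  have e4 : k - 1 - q + 1 = k - q := by ring
  unfold nbrSum reflect
  rcases hy.eq_or_lt with rfl | hy
  · by_cases h1 : x = 1
    · subst h1
      simp [e1, e3]
      ring
    · have : x ≠ 0 := by omega
      simp [h1, e1, e3, this]
      ring
  · have h0 : y ≠ 0 := by omega
    have h0' : y + 1 ≠ 0 := by omega
    have hx0 : x ≠ 0 := by omega
    by_cases h1 : x = 1 <;> by_cases h2 : y = 1
    · subst h1 h2
      simp [e2, e4]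
      ring
    · have : y - 1 ≠ 0 := by omega
      subst h1
      simp [e2, h0, h0', h2, this]
      ring
    · subst h2
      simp [e4, h1, hx0]
      ring
    · have : y - 1 ≠ 0 := by omega
      simp [h0, h0', h2, h1, hx0, this]
      ring

theorem nbrSum_sub (f g : ℤ → ℤ → ℤ → ℤ) (q x y : ℤ) :
    nbrSum (fun q x y => f q x y - g q x y) q x y = nbrSum f q x y - nbrSum g q x y := by
  unfold nbrSum
  split_ifs <;> ring

theorem count_add_six (n : ℕ) (q x y : ℤ) : count n (q + 6) x y = count n q x y := by
  induction n generalizing q x y with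
  | zero => simp [count]
  | succ n ih =>
    have e1 : q + 6 + 1 = q + 1 + 6 := by ring
    have e2 : q + 6 - 1 = q - 1 + 6 := by ring
    simp only [count, nbrSum, e1, e2, ih]

theorem reflect_zero_count (n : ℕ) {q x y : ℤ} (hx : 0 < x) (hy : 0 ≤ y) :
    reflect 0 (count n) q x y = count n q x y := by
  induction n generalizing q x y with
  | zero =>
    have : x ≠ 0 := by omega
    by_cases h : y = 0 <;> simp [reflect, count, h, this]
  | succ n ih =>
    rw [count, ← nbrSum_reflect 0 _ hx hy]
    exact nbrSum_congr (fun q x y hx hy => ih hx hy) hx hy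

theorem altCount_succ (k : ℤ) (n : ℕ) {q x y : ℤ} (hx : 0 < x) (hy : 0 ≤ y) :
    altCount k (n + 1) q x y = nbrSum (altCount k n) q x y := by
  unfold altCount
  rw [nbrSum_sub, nbrSum_reflect k _ hx hy, count]

theorem altCount_three_eq_four (n : ℕ) : altCount 3 n 0 1 1 = altCount 4 n 0 1 1 := by
  have h := reflect_zero_count n (q := 3) (x := 1) (y := 1) (by omega) (by omega)
  have h6 := count_add_six n (-4) 1 1
  simp [reflect] at h
  simp at h6
  simp [altCount, reflect, ← h, h6]

/-! ### The sectors `(-π/2, π)` and `(-3π/4, 3π/4)` -/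

/-- The function on `ℤ²` that agrees with `f` on the sector `(-π/2, π)` and is zero elsewhere. -/
def squareChart (f : ℤ → ℤ → ℤ → ℤ) (x y : ℤ) : ℤ :=
  if 0 < x ∧ 0 ≤ y then f 0 x y else if x ≤ 0 ∧ 0 < y then f 1 y (-x) else
    if 0 < x ∧ y < 0 then f (-1) (-y) x else 0

/-- The function on `ℤ²` that agrees with `f` on the sector `(-3π/4, 3π/4)` and is zero
elsewhere. -/
def diagChart (f : ℤ → ℤ → ℤ → ℤ) (x y : ℤ) : ℤ :=
  if 0 < x ∧ 0 ≤ y then f 0 x y else if x ≤ 0 ∧ -x < y then f 1 y (-x) else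
    if 0 ≤ x ∧ y < 0 then f (-1) (-y) x else if x < 0 ∧ y < x then f (-2) (-x) (-y) else 0

theorem altCount_four_two (n : ℕ) (x : ℤ) : altCount 4 n 2 x 0 = 0 := by
  simp [altCount, reflect]

theorem altCount_four_neg_one (n : ℕ) (x : ℤ) : altCount 4 n (-1) x 0 = 0 := by
  have := count_add_six n (-1) x 0
  simp at this
  simp [altCount, reflect, this]

theorem altCount_three_one (n : ℕ) {x : ℤ} (hx : 0 < x) : altCount 3 n 1 x x = 0 := by
  simp [altCount, reflect, hx.ne']

theorem altCount_three_neg_two (n : ℕ) {x : ℤ} (hx : 0 < x) : altCount 3 n (-2) x x = 0 := by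
  have := count_add_six n (-2) x x
  simp at this
  simp [altCount, reflect, hx.ne', this]

theorem squareChart_succ (n : ℕ) {x y : ℤ} (h : 0 < x ∨ 0 < y) :
    squareChart (altCount 4 (n + 1)) x y =
      squareChart (altCount 4 n) (x + 1) y + squareChart (altCount 4 n) (x - 1) y +
      squareChart (altCount 4 n) x (y + 1) + squareChart (altCount 4 n) x (y - 1) := by
  have z1 := altCount_four_two n
  have z2 := altCount_four_neg_one n
  have e1 : (1 : ℤ) + 1 = 2 := rfl
  have e2 : (0 : ℤ) - 1 = -1 := rfl
  have e3 : (1 : ℤ) - 1 = 0 := rfl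
  have e4 : (-1 : ℤ) + 1 = 0 := rfl
  rcases lt_or_ge 0 x with hx | hx
  · rcases lt_or_ge y 0 with hy | hy
    · have : squareChart (altCount 4 (n + 1)) x y = altCount 4 (n + 1) (-1) (-y) x := by
        simp (disch := omega) only [squareChart, if_pos, if_neg]
      rw [this, altCount_succ _ _ (by omega) (by omega)]
      unfold nbrSum squareChart
      by_cases h1 : x = 1 <;> by_cases h2 : y = -1 <;>
        simp (disch := omega) only [if_pos, if_neg] <;>
        (try simp only [h1, h2, z2, e1, e3, e4]) <;> ring_nf
    · have : squareChart (altCount 4 (n + 1)) x y = altCount 4 (n + 1) 0 x y := by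
        simp (disch := omega) only [squareChart, if_pos]
      rw [this, altCount_succ _ _ (by omega) (by omega)]
      unfold nbrSum squareChart
      by_cases h1 : x = 1 <;> by_cases h2 : y = 0 <;>
        simp (disch := omega) only [if_pos, if_neg] <;>
        (try simp only [h1, h2, e1, e2, e3]) <;> ring_nf
  · have : squareChart (altCount 4 (n + 1)) x y = altCount 4 (n + 1) 1 y (-x) := by
      simp (disch := omega) only [squareChart, if_pos, if_neg]
    rw [this, altCount_succ _ _ (by omega) (by omega)]
    unfold nbrSum squareChart
    by_cases h1 : x = 0 <;> by_cases h2 : y = 1 <;>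
      simp (disch := omega) only [if_pos, if_neg] <;>
      (try simp only [h1, h2, z1, e1, e2, e3]) <;> ring_nf

theorem diagChart_succ (n : ℕ) {x y : ℤ} (h : y < x ∨ -y < x) :
    diagChart (altCount 3 (n + 1)) x y =
      diagChart (altCount 3 n) (x + 1) y + diagChart (altCount 3 n) (x - 1) y +
      diagChart (altCount 3 n) x (y + 1) + diagChart (altCount 3 n) x (y - 1) := by
  have z1 (x y) (hx : 0 < x) (h : x = y) : altCount 3 n 1 x y = 0 :=
    h ▸ altCount_three_one n hx
  have z2 (x y) (hx : 0 < x) (h : x = y) : altCount 3 n (-2) x y = 0 :=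
    h ▸ altCount_three_neg_two n hx
  have e1 : (1 : ℤ) - 1 = 0 := rfl
  have e2 : (0 : ℤ) - 1 = -1 := rfl
  have e3 : (-1 : ℤ) - 1 = -2 := rfl
  have e4 : (-1 : ℤ) + 1 = 0 := rfl
  have e5 : (-2 : ℤ) + 1 = -1 := rfl
  rcases le_or_gt 0 y with hy | hy
  · rcases lt_or_ge 0 x with hx | hx
    · have : diagChart (altCount 3 (n + 1)) x y = altCount 3 (n + 1) 0 x y := by
        simp (disch := omega) only [diagChart, if_pos]
      rw [this, altCount_succ _ _ (by omega) (by omega)]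
      unfold nbrSum diagChart
      by_cases h1 : x = 1 <;> by_cases h2 : y = 0 <;>
        (try simp (disch := omega) only [if_pos, if_neg, z1, z2, e2]) <;>
        (try simp only [h1, h2]) <;> ring_nf
    · have : diagChart (altCount 3 (n + 1)) x y = altCount 3 (n + 1) 1 y (-x) := by
        simp (disch := omega) only [diagChart, if_pos, if_neg]
      rw [this, altCount_succ _ _ (by omega) (by omega)]
      unfold nbrSum diagChart
      by_cases h1 : x = 0 <;> by_cases h2 : y = -x + 1 <;>
        (try simp (disch := omega) only [if_pos, if_neg, z1, z2, e1]) <;>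
        (try simp only [h1, h2]) <;> ring_nf
  · rcases le_or_gt 0 x with hx | hx
    · have : diagChart (altCount 3 (n + 1)) x y = altCount 3 (n + 1) (-1) (-y) x := by
        simp (disch := omega) only [diagChart, if_pos, if_neg]
      rw [this, altCount_succ _ _ (by omega) (by omega)]
      unfold nbrSum diagChart
      by_cases h1 : x = 0 <;> by_cases h2 : y = -1 <;>
        (try simp (disch := omega) only [if_pos, if_neg, z1, z2, e3, e4]) <;>
        (try simp only [h1, h2]) <;> ring_nf
    · have : diagChart (altCount 3 (n + 1)) x y = altCount 3 (n + 1) (-2) (-x) (-y) := by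
        simp (disch := omega) only [diagChart, if_pos, if_neg]
      rw [this, altCount_succ _ _ (by omega) (by omega)]
      unfold nbrSum diagChart
      by_cases h1 : x = -1 <;> by_cases h2 : y = x - 1 <;>
        (try simp (disch := omega) only [if_pos, if_neg, z1, z2, e5]) <;>
        (try simp only [h1, h2]) <;> ring_nf

theorem walkCount_square_eq (n : ℕ) (i j : ℤ) :
    (walkCount squareSteps coneC (i, j) (-1, 0) n : ℤ) =
      squareChart (altCount 4 n) (j + 1) (i + 1) := by
  induction n generalizing i j with
  | zero =>
    by_cases h : (i, j) ∈ coneC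
    · rw [walkCount_zero h]
      simp only [coneC, Set.mem_ofPred_eq] at h
      simp only [squareChart, altCount, reflect, count, Prod.mk.injEq]
      push_cast
      split_ifs <;> grind
    · rw [walkCount_of_notMem h]
      simp only [coneC, Set.mem_ofPred_eq] at h
      simp (disch := omega) only [squareChart, if_neg, Nat.cast_zero]
  | succ n ih =>
    by_cases h : (i, j) ∈ coneC
    · rw [walkCount_squareSteps_succ _ n h]
      simp only [coneC, Set.mem_ofPred_eq] at h
      rw [squareChart_succ n (by omega)]
      push_cast
      simp only [ih]
      ring_nf
    · rw [walkCount_of_notMem h]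
      simp only [coneC, Set.mem_ofPred_eq] at h
      simp (disch := omega) only [squareChart, if_neg, Nat.cast_zero]

theorem walkCount_diag_eq (n : ℕ) (x y : ℤ) :
    (walkCount diagSteps coneC (x - 1 - y, x - 1 + y) (0, 0) n : ℤ) =
      diagChart (altCount 3 n) x y := by
  induction n generalizing x y with
  | zero =>
    by_cases h : (x - 1 - y, x - 1 + y) ∈ coneC
    · rw [walkCount_zero h]
      simp only [coneC, Set.mem_ofPred_eq] at h
      simp only [diagChart, altCount, reflect, count, Prod.mk.injEq]
      push_cast
      split_ifs <;> grind
    · rw [walkCount_of_notMem h]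
      simp only [coneC, Set.mem_ofPred_eq] at h
      simp (disch := omega) only [diagChart, if_neg, Nat.cast_zero]
  | succ n ih =>
    by_cases h : (x - 1 - y, x - 1 + y) ∈ coneC
    · rw [walkCount_diagSteps_succ _ n h]
      simp only [coneC, Set.mem_ofPred_eq] at h
      rw [diagChart_succ n (by omega)]
      push_cast
      simp only [← ih]
      ring_nf
    · rw [walkCount_of_notMem h]
      simp only [coneC, Set.mem_ofPred_eq] at h
      simp (disch := omega) only [diagChart, if_neg, Nat.cast_zero]

end QuadrantCover

open QuadrantCover in
theorem square_eq_diag_coincidence (n : ℕ) :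
    walkCount squareSteps coneC (0, 0) (-1, 0) n =
      walkCount diagSteps coneC (0, 0) (-1, 1) n := by
  have hneg : ∀ s ∈ diagSteps, -s ∈ diagSteps := by
    rintro s (rfl | rfl | rfl | rfl) <;> simp [diagSteps]
  rw [walkCount_comm hneg]
  have h1 := walkCount_square_eq n 0 0
  have h2 := walkCount_diag_eq n 1 1
  simp [squareChart] at h1
  simp [diagChart] at h2
  have h3 := altCount_three_eq_four n
  omega
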